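/- Let d = 3, p = 5, let σ, λ, κ ∈ ℝ, and let V(x) = (1/2) Σ_{j=1}^3 ω_j² x_j² with ω_j ∈ ℝ. Let u be a classical compactly supported solution of the damped NLS on [0,∞). Define E_κ(t) = ∫_{ℝ³} (1/2)|∇u(t,x)|² + V(x)|u(t,x)|² + (λ/2)|u(t,x)|⁴ + κ|u(t,x)|⁶ dx. Then for every t ≥ 0 the function E_κ is differentiable at t with derivative E_κ'(t) = −σ ∫ ρ|∇ρ|² − (σ − 6κ) ∫ ρ²|∇u|² − 2σλ ∫ ρ⁴ − 6κ ∫ ρ |(1/2)∇ρ − J|² − 6σκ ∫ ρ⁵ − 2σ ∫ V ρ³, where ρ = |u(t,·)|², J = Im( conj(u(t,·)) ∇u(t,·) ), and all integrals are over ℝ³. -/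

import Mathlib

open MeasureTheory

/-- Spatial partial derivative in direction `j` of a complex-valued function on `ℝ^d`. -/
noncomputable def sd {d : ℕ} (v : EuclideanSpace ℝ (Fin d) → ℂ) (j : Fin d)
    (x : EuclideanSpace ℝ (Fin d)) : ℂ :=
  fderiv ℝ v x (EuclideanSpace.single j 1)

/-- Spatial Laplacian of a complex-valued function on `ℝ^d`. -/
noncomputable def lap {d : ℕ} (v : EuclideanSpace ℝ (Fin d) → ℂ)
    (x : EuclideanSpace ℝ (Fin d)) : ℂ :=
  ∑ j, sd (sd v j) j x

/-- A classical, compactly supported solution of the damped NLS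
`i ∂_t u + (1/2) Δ u = V u + λ|u|²u − iσ|u|^{p−1}u` on `[0,∞)`:
`u` is `C^∞` on all of `ℝ × ℝ^d`, satisfies the equation for all `t ≥ 0` and all `x`,
and vanishes outside a fixed compact set in space for all `t ≥ 0`. -/
def IsSol (d : ℕ) (p σ lam : ℝ) (V : EuclideanSpace ℝ (Fin d) → ℝ)
    (u : ℝ → EuclideanSpace ℝ (Fin d) → ℂ) : Prop :=
  ContDiff ℝ (⊤ : ℕ∞) (Function.uncurry u) ∧
  (∀ t ≥ (0 : ℝ), ∀ x,
    Complex.I * deriv (fun s => u s x) t + (1 / 2 : ℂ) * lap (u t) x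
      = (V x : ℂ) * u t x + (lam : ℂ) * ((‖u t x‖ ^ 2 : ℝ) : ℂ) * u t x
        - Complex.I * (σ : ℂ) * ((‖u t x‖ ^ (p - 1) : ℝ) : ℂ) * u t x) ∧
  ∃ K : Set (EuclideanSpace ℝ (Fin d)), IsCompact K ∧
    ∀ t ≥ (0 : ℝ), ∀ x, x ∉ K → u t x = 0

/-- The partial derivative in the first variable of a differentiable function on a product. -/
theorem hasDerivAt_uncurry_left {E G : Type*} [NormedAddCommGroup E] [NormedSpace ℝ E]
    [NormedAddCommGroup G] [NormedSpace ℝ G] {F : ℝ → E → G}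
    (hF : Differentiable ℝ (Function.uncurry F)) (s : ℝ) (x : E) :
    HasDerivAt (fun s => F s x) (fderiv ℝ (Function.uncurry F) (s, x) (1, 0)) s := by
  have h : HasDerivAt (fun s : ℝ => (s, x)) ((1 : ℝ), (0 : E)) s :=
    (hasDerivAt_id s).prodMk (hasDerivAt_const s x)
  exact (hF (s, x)).hasFDerivAt.comp_hasDerivAt s h

/-- Differentiation under the integral sign over a compact set, for a `C¹` integrand. -/
theorem hasDerivAt_setIntegral_of_contDiff {E : Type*} [NormedAddCommGroup E] [NormedSpace ℝ E]
    [MeasurableSpace E] [BorelSpace E] [SecondCountableTopology E]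
    {μ : Measure E} [IsFiniteMeasureOnCompacts μ] {K : Set E} (hK : IsCompact K)
    {F : ℝ → E → ℝ} (hF : ContDiff ℝ 1 (Function.uncurry F)) (t : ℝ) :
    HasDerivAt (fun s => ∫ x in K, F s x ∂μ) (∫ x in K, deriv (fun s => F s x) t ∂μ) t := by
  have hderiv := hasDerivAt_uncurry_left (hF.differentiable one_ne_zero)
  have hcont : Continuous fun z : ℝ × E => fderiv ℝ (Function.uncurry F) z (1, 0) :=
    (hF.continuous_fderiv one_ne_zero).clm_apply continuous_const
  obtain ⟨C, hC⟩ := ((isCompact_Icc (a := t - 1) (b := t + 1)).prod hK).exists_bound_of_continuousOn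
    hcont.continuousOn
  have hslice : ∀ s, Continuous (F s) := fun s =>
    hF.continuous.comp (Continuous.prodMk_right s)
  have hmain := (hasDerivAt_integral_of_dominated_loc_of_deriv_le (μ := μ.restrict K)
    (F := F) (F' := fun s x => fderiv ℝ (Function.uncurry F) (s, x) (1, 0))
    (bound := fun _ => C) (x₀ := t) (Icc_mem_nhds (by linarith) (by linarith))
    (Filter.Eventually.of_forall fun s => (hslice s).aestronglyMeasurable)
    ((hslice t).continuousOn.integrableOn_compact hK)
    (hcont.comp (Continuous.prodMk_right t)).aestronglyMeasurable
    ((ae_restrict_iff' hK.measurableSet).2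
      (Filter.Eventually.of_forall fun x hx s hs => hC (s, x) ⟨hs, hx⟩))
    (continuousOn_const.integrableOn_compact hK)
    (Filter.Eventually.of_forall fun x s _ => hderiv s x)).2
  simpa only [(hderiv t _).deriv] using hmain

/-- The directional derivative of a compactly supported `C¹` function has zero integral. -/
theorem integral_fderiv_eq_zero_of_hasCompactSupport {E : Type*} [NormedAddCommGroup E]
    [NormedSpace ℝ E] [FiniteDimensional ℝ E] [MeasurableSpace E] [BorelSpace E]
    {μ : Measure E} [μ.IsAddHaarMeasure] {g : E → ℝ} (hg : ContDiff ℝ 1 g)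
    (hsupp : HasCompactSupport g) (v : E) : ∫ x, fderiv ℝ g x v ∂μ = 0 := by
  have hint : Integrable (fun x => fderiv ℝ g x v) μ :=
    ((hg.continuous_fderiv one_ne_zero).clm_apply continuous_const).integrable_of_hasCompactSupport
      (hsupp.fderiv_apply ℝ v)
  simpa using integral_mul_fderiv_eq_neg_fderiv_mul_of_integrable (μ := μ) (v := v)
    (f := fun _ => (1 : ℝ)) (g := g) (by simp) (by simpa using hint)
    (by simpa using hg.continuous.integrable_of_hasCompactSupport hsupp)
    (fun x _ => differentiableAt_const _) (fun x _ => hg.differentiable one_ne_zero x)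

section SpaceTime

variable {d : ℕ} {u : ℝ → EuclideanSpace ℝ (Fin d) → ℂ}

theorem sd_eq_fderiv_uncurry (hu : ContDiff ℝ (⊤ : ℕ∞) (Function.uncurry u)) (j : Fin d) (s : ℝ)
    (x : EuclideanSpace ℝ (Fin d)) :
    sd (u s) j x = fderiv ℝ (Function.uncurry u) (s, x) (0, EuclideanSpace.single j 1) := by
  have h : HasFDerivAt (u s) _ x := (hu.differentiable (by simp) (s, x)).hasFDerivAt.comp x
    ((hasFDerivAt_const s x).prodMk (hasFDerivAt_id x))
  rw [sd, h.fderiv]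
  simp

theorem contDiff_fderiv_uncurry_apply (hu : ContDiff ℝ (⊤ : ℕ∞) (Function.uncurry u))
    (v : ℝ × EuclideanSpace ℝ (Fin d)) :
    ContDiff ℝ (⊤ : ℕ∞) fun z => fderiv ℝ (Function.uncurry u) z v :=
  (hu.fderiv_right (by simp)).clm_apply contDiff_const

theorem contDiff_uncurry_sd (hu : ContDiff ℝ (⊤ : ℕ∞) (Function.uncurry u)) (j : Fin d) :
    ContDiff ℝ (⊤ : ℕ∞) (Function.uncurry fun s => sd (u s) j) := by
  convert contDiff_fderiv_uncurry_apply hu (0, EuclideanSpace.single j 1) with z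
  exact sd_eq_fderiv_uncurry hu j z.1 z.2

theorem contDiff_uncurry_deriv (hu : ContDiff ℝ (⊤ : ℕ∞) (Function.uncurry u)) :
    ContDiff ℝ (⊤ : ℕ∞) (Function.uncurry fun s x => deriv (fun s => u s x) s) := by
  convert contDiff_fderiv_uncurry_apply hu (1, 0) with z
  exact (hasDerivAt_uncurry_left (hu.differentiable (by simp)) z.1 z.2).deriv

theorem contDiff_slice (hu : ContDiff ℝ (⊤ : ℕ∞) (Function.uncurry u)) (s : ℝ) :
    ContDiff ℝ (⊤ : ℕ∞) (u s) :=
  hu.comp (contDiff_prodMk_right s)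

/-- Time and space derivatives commute. -/
theorem deriv_sd_eq_sd_deriv (hu : ContDiff ℝ (⊤ : ℕ∞) (Function.uncurry u)) (j : Fin d) (s : ℝ)
    (x : EuclideanSpace ℝ (Fin d)) :
    deriv (fun s => sd (u s) j x) s = sd (fun y => deriv (fun s => u s y) s) j x := by
  have hsnd : DifferentiableAt ℝ (fderiv ℝ (Function.uncurry u)) (s, x) :=
    (hu.fderiv_right (m := (⊤ : ℕ∞)) (by simp)).differentiable (by simp) _
  have hsymm : IsSymmSndFDerivAt ℝ (Function.uncurry u) (s, x) :=
    hu.contDiffAt.isSymmSndFDerivAt (by simpa using WithTop.coe_le_coe.2 (le_top (a := (2 : ℕ∞))))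
  have hsplit : ∀ v w, fderiv ℝ (fun z => fderiv ℝ (Function.uncurry u) z v) (s, x) w
      = fderiv ℝ (fderiv ℝ (Function.uncurry u)) (s, x) w v := fun v w => by
    rw [fderiv_clm_apply hsnd (differentiableAt_const v)]
    simp
  rw [(hasDerivAt_uncurry_left ((contDiff_uncurry_sd hu j).differentiable (by simp)) s x).deriv,
    sd_eq_fderiv_uncurry (u := fun s y => deriv (fun s => u s y) s) (contDiff_uncurry_deriv hu)]
  rw [show (Function.uncurry fun s => sd (u s) j) =
      fun z => fderiv ℝ (Function.uncurry u) z (0, EuclideanSpace.single j 1) from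
      funext fun z => sd_eq_fderiv_uncurry hu j z.1 z.2,
    show (Function.uncurry fun s x => deriv (fun s => u s x) s) =
      fun z => fderiv ℝ (Function.uncurry u) z (1, 0) from
      funext fun z => (hasDerivAt_uncurry_left (hu.differentiable (by simp)) z.1 z.2).deriv,
    hsplit, hsplit, hsymm]

end SpaceTime

section Slice

variable {d : ℕ}

theorem fderiv_eq_zero_of_notMem {E G : Type*} [NormedAddCommGroup E] [NormedSpace ℝ E]
    [NormedAddCommGroup G] [NormedSpace ℝ G] {v : E → G} {K : Set E} (hK : IsClosed K)
    (hv : ∀ x ∉ K, v x = 0) {x : E} (hx : x ∉ K) : fderiv ℝ v x = 0 := by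
  have h : v =ᶠ[nhds x] fun _ => 0 := by
    filter_upwards [hK.isOpen_compl.mem_nhds hx] with y hy using hv y hy
  rw [h.fderiv_eq, fderiv_fun_const, Pi.zero_apply]

theorem contDiff_sd {v : EuclideanSpace ℝ (Fin d) → ℂ} (hv : ContDiff ℝ (⊤ : ℕ∞) v)
    (j : Fin d) : ContDiff ℝ (⊤ : ℕ∞) (sd v j) :=
  (hv.fderiv_right (by simp)).clm_apply contDiff_const

theorem hasLineDerivAt_sd {v : EuclideanSpace ℝ (Fin d) → ℂ} (hv : Differentiable ℝ v) (j : Fin d)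
    (x : EuclideanSpace ℝ (Fin d)) :
    HasLineDerivAt ℝ v (sd v j x) x (EuclideanSpace.single j 1) :=
  (hv x).hasFDerivAt.hasLineDerivAt _

theorem fderiv_norm_sq_single {v : EuclideanSpace ℝ (Fin d) → ℂ} (hv : Differentiable ℝ v)
    (j : Fin d) (x : EuclideanSpace ℝ (Fin d)) :
    fderiv ℝ (fun y => ‖v y‖ ^ 2) x (EuclideanSpace.single j 1)
      = 2 * inner ℝ (v x) (sd v j x) := by
  rw [← ((hv x).norm_sq ℝ).lineDeriv_eq_fderiv]
  simpa [lineDeriv] using (HasDerivAt.norm_sq (hasLineDerivAt_sd hv j x)).deriv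

end Slice

/-- The components of the flux whose divergence accounts for the integrations by parts in the
energy balance. -/
noncomputable def energyFlux {d : ℕ} (σ κ : ℝ) (v a : EuclideanSpace ℝ (Fin d) → ℂ) (j : Fin d)
    (x : EuclideanSpace ℝ (Fin d)) : ℝ :=
  inner ℝ (a x) (sd v j x) + σ * ((‖v x‖ ^ 2) ^ 2 * inner ℝ (v x) (sd v j x))
    - 3 * κ * ((‖v x‖ ^ 2) ^ 2 * inner ℝ (Complex.I * v x) (sd v j x))

theorem contDiff_energyFlux {d : ℕ} (σ κ : ℝ) {v a : EuclideanSpace ℝ (Fin d) → ℂ}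
    (hv : ContDiff ℝ (⊤ : ℕ∞) v) (ha : ContDiff ℝ (⊤ : ℕ∞) a) (j : Fin d) :
    ContDiff ℝ (⊤ : ℕ∞) (energyFlux σ κ v a j) := by
  have hs := contDiff_sd hv j
  have hn : ContDiff ℝ (⊤ : ℕ∞) fun x => ‖v x‖ ^ 2 := hv.norm_sq ℝ
  exact ((ha.inner ℝ hs).add (contDiff_const.mul ((hn.pow 2).mul (hv.inner ℝ hs)))).sub
    (contDiff_const.mul ((hn.pow 2).mul ((contDiff_const.mul hv).inner ℝ hs)))

theorem fderiv_energyFlux_single {d : ℕ} (σ κ : ℝ) {v a : EuclideanSpace ℝ (Fin d) → ℂ}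
    (hv : ContDiff ℝ (⊤ : ℕ∞) v) (ha : ContDiff ℝ (⊤ : ℕ∞) a) (j : Fin d)
    (x : EuclideanSpace ℝ (Fin d)) :
    fderiv ℝ (energyFlux σ κ v a j) x (EuclideanSpace.single j 1)
      = inner ℝ (a x) (sd (sd v j) j x) + inner ℝ (sd a j x) (sd v j x)
        + σ * (4 * ‖v x‖ ^ 2 * (inner ℝ (v x) (sd v j x)) ^ 2
          + (‖v x‖ ^ 2) ^ 2 * (inner ℝ (v x) (sd (sd v j) j x) + ‖sd v j x‖ ^ 2))
        - 3 * κ * (4 * ‖v x‖ ^ 2 * inner ℝ (v x) (sd v j x)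
            * inner ℝ (Complex.I * v x) (sd v j x)
          + (‖v x‖ ^ 2) ^ 2 * inner ℝ (Complex.I * v x) (sd (sd v j) j x)) := by
  have hsm := contDiff_sd hv j
  rw [← ((contDiff_energyFlux σ κ hv ha j).differentiable (by simp) x).lineDeriv_eq_fderiv]
  have h0 : HasDerivAt _ _ (0 : ℝ) := hasLineDerivAt_sd (hv.differentiable (by simp)) j x
  have h1 : HasDerivAt _ _ (0 : ℝ) := hasLineDerivAt_sd (hsm.differentiable (by simp)) j x
  have h2 : HasDerivAt _ _ (0 : ℝ) := hasLineDerivAt_sd (ha.differentiable (by simp)) j x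
  have h3 := ((h2.inner ℝ h1).add (((h0.norm_sq.pow 2).mul (h0.inner ℝ h1)).const_mul σ)).sub
    (((h0.norm_sq.pow 2).mul ((h0.const_mul Complex.I).inner ℝ h1)).const_mul (3 * κ))
  have h4 : lineDeriv ℝ (energyFlux σ κ v a j) x (EuclideanSpace.single j 1) = _ :=
    HasDerivAt.deriv h3
  have h5 : inner ℝ (Complex.I * sd v j x) (sd v j x) = 0 := by
    simp [Complex.inner]; ring
  rw [h4]
  simp [h5]
  ring

/-- The pointwise energy balance: `u`, `a`, `D`, `DD`, `A` stand for the values at a point of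
`u`, `∂ₜu`, `∂ⱼu`, `∂ⱼ²u`, `∂ⱼ∂ₜu`. -/
theorem energy_density_balance {d : ℕ} (σ lam κ V : ℝ) (u a : ℂ) (D DD A : Fin d → ℂ)
    (h : Complex.I * a + (1 / 2 : ℂ) * ∑ j, DD j
      = (V : ℂ) * u + (lam : ℂ) * ((‖u‖ ^ 2 : ℝ) : ℂ) * u
        - Complex.I * (σ : ℂ) * ((‖u‖ ^ 4 : ℝ) : ℂ) * u) :
    ∑ j, inner ℝ (D j) (A j) + 2 * V * inner ℝ u a + 2 * lam * ‖u‖ ^ 2 * inner ℝ u a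
        + 6 * κ * (‖u‖ ^ 2) ^ 2 * inner ℝ u a
      = -σ * (‖u‖ ^ 2 * ∑ j, (2 * inner ℝ u (D j)) ^ 2)
          - (σ - 6 * κ) * ((‖u‖ ^ 2) ^ 2 * ∑ j, ‖D j‖ ^ 2)
          - 2 * σ * lam * (‖u‖ ^ 2) ^ 4
          - 6 * κ * (‖u‖ ^ 2 * ∑ j, ((1 / 2) * (2 * inner ℝ u (D j))
              - ((starRingEnd ℂ) u * D j).im) ^ 2)
          - 6 * σ * κ * (‖u‖ ^ 2) ^ 5
          - 2 * σ * (V * (‖u‖ ^ 2) ^ 3)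
        + ∑ j, (inner ℝ a (DD j) + inner ℝ (A j) (D j)
          + σ * (4 * ‖u‖ ^ 2 * (inner ℝ u (D j)) ^ 2
            + (‖u‖ ^ 2) ^ 2 * (inner ℝ u (DD j) + ‖D j‖ ^ 2))
          - 3 * κ * (4 * ‖u‖ ^ 2 * inner ℝ u (D j) * inner ℝ (Complex.I * u) (D j)
            + (‖u‖ ^ 2) ^ 2 * inner ℝ (Complex.I * u) (DD j))) := by
  have hnorm : ∀ z : ℂ, ‖z‖ ^ 2 = z.re ^ 2 + z.im ^ 2 := fun z => by
    rw [← Complex.normSq_eq_norm_sq, Complex.normSq_apply]; ring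
  have hdir : ∑ j, (inner ℝ (D j) (A j) + σ * (‖u‖ ^ 2 * (2 * inner ℝ u (D j)) ^ 2)
      + (σ - 6 * κ) * ((‖u‖ ^ 2) ^ 2 * ‖D j‖ ^ 2)
      + 6 * κ * (‖u‖ ^ 2 * ((1 / 2) * (2 * inner ℝ u (D j)) - ((starRingEnd ℂ) u * D j).im) ^ 2)
      - (inner ℝ a (DD j) + inner ℝ (A j) (D j)
          + σ * (4 * ‖u‖ ^ 2 * (inner ℝ u (D j)) ^ 2
            + (‖u‖ ^ 2) ^ 2 * (inner ℝ u (DD j) + ‖D j‖ ^ 2))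
          - 3 * κ * (4 * ‖u‖ ^ 2 * inner ℝ u (D j) * inner ℝ (Complex.I * u) (D j)
            + (‖u‖ ^ 2) ^ 2 * inner ℝ (Complex.I * u) (DD j))))
      = ∑ j, (-inner ℝ a (DD j) - σ * ((‖u‖ ^ 2) ^ 2 * inner ℝ u (DD j))
          + 3 * κ * ((‖u‖ ^ 2) ^ 2 * inner ℝ (Complex.I * u) (DD j))) := by
    refine Finset.sum_congr rfl fun j _ => ?_
    simp only [hnorm, Complex.inner, Complex.mul_re, Complex.mul_im, Complex.conj_re,
      Complex.conj_im, Complex.I_re, Complex.I_im, map_mul]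
    ring
  simp only [Finset.sum_add_distrib, Finset.sum_sub_distrib, Finset.sum_neg_distrib,
    ← Finset.mul_sum, ← inner_sum] at hdir ⊢
  have hlap : 2 * V * inner ℝ u a + 2 * lam * ‖u‖ ^ 2 * inner ℝ u a
        + 6 * κ * (‖u‖ ^ 2) ^ 2 * inner ℝ u a - inner ℝ a (∑ j, DD j)
        - σ * ((‖u‖ ^ 2) ^ 2 * inner ℝ u (∑ j, DD j))
        + 3 * κ * ((‖u‖ ^ 2) ^ 2 * inner ℝ (Complex.I * u) (∑ j, DD j))
      = -2 * σ * lam * (‖u‖ ^ 2) ^ 4 - 6 * σ * κ * (‖u‖ ^ 2) ^ 5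
        - 2 * σ * (V * (‖u‖ ^ 2) ^ 3) := by
    generalize ∑ j, DD j = L at h
    have h4 : ‖u‖ ^ 4 = (‖u‖ ^ 2) ^ 2 := by ring
    rw [h4] at h
    have hre := congrArg Complex.re h
    have him := congrArg Complex.im h
    have hN := hnorm u
    generalize ‖u‖ ^ 2 = N at *
    simp [Complex.inner, -Complex.ofReal_pow] at hre him ⊢
    linear_combination
      2 * (-a.re - σ * N ^ 2 * u.re - 3 * κ * N ^ 2 * u.im) * hre
      + 2 * (-a.im - σ * N ^ 2 * u.im + 3 * κ * N ^ 2 * u.re) * him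
      + (2 * V * N ^ 2 * σ + 2 * lam * N ^ 3 * σ + 6 * N ^ 4 * κ * σ) * hN
  linear_combination hdir + hlap

theorem deriv_energyDensity {d : ℕ} {u : ℝ → EuclideanSpace ℝ (Fin d) → ℂ}
    (hu : ContDiff ℝ (⊤ : ℕ∞) (Function.uncurry u)) (lam κ V t : ℝ)
    (x : EuclideanSpace ℝ (Fin d)) :
    deriv (fun s => (1 / 2) * ∑ j, ‖sd (u s) j x‖ ^ 2 + V * ‖u s x‖ ^ 2
        + (lam / 2) * ‖u s x‖ ^ 4 + κ * ‖u s x‖ ^ 6) t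
      = ∑ j, inner ℝ (sd (u t) j x) (sd (fun y => deriv (fun s => u s y) t) j x)
        + 2 * V * inner ℝ (u t x) (deriv (fun s => u s x) t)
        + 2 * lam * ‖u t x‖ ^ 2 * inner ℝ (u t x) (deriv (fun s => u s x) t)
        + 6 * κ * (‖u t x‖ ^ 2) ^ 2 * inner ℝ (u t x) (deriv (fun s => u s x) t) := by
  have h0 : HasDerivAt (fun s => u s x) (deriv (fun s => u s x) t) t :=
    (hasDerivAt_uncurry_left (hu.differentiable (by simp)) t x).differentiableAt.hasDerivAt
  have h1 : ∀ j, HasDerivAt (fun s => sd (u s) j x)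
      (sd (fun y => deriv (fun s => u s y) t) j x) t := fun j => by
    rw [← deriv_sd_eq_sd_deriv hu]
    exact (hasDerivAt_uncurry_left ((contDiff_uncurry_sd hu j).differentiable (by simp))
      t x).differentiableAt.hasDerivAt
  have h2 := ((((HasDerivAt.fun_sum (u := Finset.univ)
    fun j _ => (h1 j).norm_sq).const_mul (1 / 2 : ℝ)).add
    (h0.norm_sq.const_mul V)).add ((h0.norm_sq.pow 2).const_mul (lam / 2))).add
    ((h0.norm_sq.pow 3).const_mul κ)
  convert h2.deriv using 1
  · congr 1
    ext s
    simp only [Pi.add_apply, Pi.pow_apply]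
    ring
  · rw [← Finset.mul_sum]
    push_cast
    ring

theorem contDiff_energyDensity {d : ℕ} {u : ℝ → EuclideanSpace ℝ (Fin d) → ℂ}
    (hu : ContDiff ℝ (⊤ : ℕ∞) (Function.uncurry u)) (lam κ : ℝ)
    {V : EuclideanSpace ℝ (Fin d) → ℝ} (hV : ContDiff ℝ (⊤ : ℕ∞) V) :
    ContDiff ℝ (⊤ : ℕ∞) (Function.uncurry fun s x => (1 / 2) * ∑ j, ‖sd (u s) j x‖ ^ 2
      + V x * ‖u s x‖ ^ 2 + (lam / 2) * ‖u s x‖ ^ 4 + κ * ‖u s x‖ ^ 6) := by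
  have hρ : ContDiff ℝ (⊤ : ℕ∞) fun z : ℝ × EuclideanSpace ℝ (Fin d) => ‖u z.1 z.2‖ ^ 2 :=
    hu.norm_sq ℝ
  have hD : ∀ j, ContDiff ℝ (⊤ : ℕ∞)
      fun z : ℝ × EuclideanSpace ℝ (Fin d) => ‖sd (u z.1) j z.2‖ ^ 2 :=
    fun j => (contDiff_uncurry_sd hu j).norm_sq ℝ
  have h := (((contDiff_const (c := (1 / 2 : ℝ))).mul
    (ContDiff.sum (s := Finset.univ) fun j _ => hD j)).add
    ((hV.comp contDiff_snd).mul hρ)).add ((contDiff_const (c := lam / 2)).mul (hρ.pow 2))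
    |>.add ((contDiff_const (c := κ)).mul (hρ.pow 3))
  refine (congrArg (ContDiff ℝ (⊤ : ℕ∞)) (funext fun z => ?_)).mpr h
  simp only [Function.uncurry, Function.comp]
  ring

/-- for `d = 3`, `p = 5`, quadratic potential
`V(x) = (1/2) Σ_j ω_j² x_j²`, and a classical compactly supported solution `u` of the
damped NLS, the energy `E_κ(t) = ∫ (1/2)|∇u|² + V|u|² + (λ/2)|u|⁴ + κ|u|⁶` is
differentiable at every `t ≥ 0` with derivative
`−σ∫ρ|∇ρ|² − (σ−6κ)∫ρ²|∇u|² − 2σλ∫ρ⁴ − 6κ∫ρ|(1/2)∇ρ−J|² − 6σκ∫ρ⁵ − 2σ∫Vρ³`,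
where `ρ = |u(t,·)|²` and `J = Im(conj(u)∇u)`. -/
theorem stmt6 (σ lam κ : ℝ) (ω : Fin 3 → ℝ)
    (V : EuclideanSpace ℝ (Fin 3) → ℝ)
    (hV : ∀ x, V x = (1 / 2) * ∑ j, (ω j) ^ 2 * (x j) ^ 2)
    (u : ℝ → EuclideanSpace ℝ (Fin 3) → ℂ)
    (hu : IsSol 3 5 σ lam V u) :
    ∀ t ≥ (0 : ℝ),
      HasDerivWithinAt
        (fun s => ∫ x, ((1 / 2) * ∑ j, ‖sd (u s) j x‖ ^ 2 + V x * ‖u s x‖ ^ 2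
          + (lam / 2) * ‖u s x‖ ^ 4 + κ * ‖u s x‖ ^ 6))
        (-σ * (∫ x, ‖u t x‖ ^ 2 * ∑ j,
              (fderiv ℝ (fun y => ‖u t y‖ ^ 2) x (EuclideanSpace.single j 1)) ^ 2)
          - (σ - 6 * κ) * (∫ x, (‖u t x‖ ^ 2) ^ 2 * ∑ j, ‖sd (u t) j x‖ ^ 2)
          - 2 * σ * lam * (∫ x, (‖u t x‖ ^ 2) ^ 4)
          - 6 * κ * (∫ x, ‖u t x‖ ^ 2 * ∑ j,
              ((1 / 2) * fderiv ℝ (fun y => ‖u t y‖ ^ 2) x (EuclideanSpace.single j 1)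
                - ((starRingEnd ℂ) (u t x) * sd (u t) j x).im) ^ 2)
          - 6 * σ * κ * (∫ x, (‖u t x‖ ^ 2) ^ 5)
          - 2 * σ * (∫ x, V x * (‖u t x‖ ^ 2) ^ 3))
        (Set.Ici 0) t := by
  obtain ⟨hsmooth, heq, K, hK, hsupp⟩ := hu
  have hVc : ContDiff ℝ (⊤ : ℕ∞) V := by
    rw [funext hV]
    fun_prop
  intro t ht
  have hut : ContDiff ℝ (⊤ : ℕ∞) (u t) := contDiff_slice hsmooth t
  have hat : ContDiff ℝ (⊤ : ℕ∞) fun x => deriv (fun s => u s x) t :=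
    contDiff_slice (contDiff_uncurry_deriv hsmooth) t
  simp only [fderiv_norm_sq_single (hut.differentiable (by simp))]
  have hsd : ∀ s ≥ (0 : ℝ), ∀ j, ∀ x ∉ K, sd (u s) j x = 0 := fun s hs j x hx =>
    by rw [sd, fderiv_eq_zero_of_notMem hK.isClosed (hsupp s hs) hx]; simp
  have hc : Continuous (u t) := hut.continuous
  have hcD : ∀ j, Continuous (sd (u t) j) := fun j => (contDiff_sd hut j).continuous
  have hcV : Continuous V := hVc.continuous
  have hint : ∀ {f : EuclideanSpace ℝ (Fin 3) → ℝ}, Continuous f → (∀ x ∉ K, f x = 0) →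
      Integrable f := fun hf hfK =>
    hf.integrable_of_hasCompactSupport (HasCompactSupport.intro hK hfK)
  set G := energyFlux σ κ (u t) (fun x => deriv (fun s => u s x) t) with hG
  have hGc : ∀ j, ContDiff ℝ 1 (G j) := fun j =>
    (contDiff_energyFlux σ κ hut hat j).of_le (by simp)
  have hGK : ∀ j, ∀ x ∉ K, G j x = 0 := fun j x hx => by
    simp [hG, energyFlux, hsd t ht j x hx]
  have hGs : ∀ j, HasCompactSupport (G j) := fun j => HasCompactSupport.intro hK (hGK j)
  have hmain := ((hasDerivAt_setIntegral_of_contDiff (μ := volume) hK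
    ((contDiff_energyDensity hsmooth lam κ hVc).of_le (by simp)) t).hasDerivWithinAt
    (s := Set.Ici 0)).congr_of_mem (fun s hs =>
      (setIntegral_eq_integral_of_forall_compl_eq_zero fun x hx => by
        simp [hsd s hs _ x hx, hsupp s hs x hx]).symm) ht
  refine hmain.congr_deriv ?_
  have hbalance : ∀ x, deriv (fun s => (1 / 2) * ∑ j, ‖sd (u s) j x‖ ^ 2
      + V x * ‖u s x‖ ^ 2 + (lam / 2) * ‖u s x‖ ^ 4 + κ * ‖u s x‖ ^ 6) t = _ := fun x =>
    (deriv_energyDensity hsmooth lam κ (V x) t x).trans <|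
      (energy_density_balance σ lam κ (V x) (u t x)
        (deriv (fun s => u s x) t) (fun j => sd (u t) j x) (fun j => sd (sd (u t) j) j x)
        (fun j => sd (fun y => deriv (fun s => u s y) t) j x) (by
          have hp : ‖u t x‖ ^ ((5 : ℝ) - 1) = ‖u t x‖ ^ 4 := by
            rw [← Real.rpow_natCast]
            norm_num
          simpa only [hp, lap] using heq t ht x)).trans <|
      congrArg₂ (· + ·) rfl (Finset.sum_congr rfl fun j _ =>
        (fderiv_energyFlux_single σ κ hut hat j x).symm)
  simp only [hbalance, ← hG]
  have h1 := hint (f := fun x => ‖u t x‖ ^ 2 * ∑ j, (2 * inner ℝ (u t x) (sd (u t) j x)) ^ 2)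
    (by fun_prop) fun x hx => by simp [hsupp t ht x hx]
  have h2 := hint (f := fun x => (‖u t x‖ ^ 2) ^ 2 * ∑ j, ‖sd (u t) j x‖ ^ 2)
    (by fun_prop) fun x hx => by simp [hsupp t ht x hx]
  have h3 := hint (f := fun x => (‖u t x‖ ^ 2) ^ 4)
    (by fun_prop) fun x hx => by simp [hsupp t ht x hx]
  have h4 := hint (f := fun x => ‖u t x‖ ^ 2 * ∑ j, ((1 / 2) * (2 * inner ℝ (u t x) (sd (u t) j x))
      - ((starRingEnd ℂ) (u t x) * sd (u t) j x).im) ^ 2)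
    (by fun_prop) fun x hx => by simp [hsupp t ht x hx]
  have h5 := hint (f := fun x => (‖u t x‖ ^ 2) ^ 5)
    (by fun_prop) fun x hx => by simp [hsupp t ht x hx]
  have h6 := hint (f := fun x => V x * (‖u t x‖ ^ 2) ^ 3)
    (by fun_prop) fun x hx => by simp [hsupp t ht x hx]
  have h7 : ∀ j ∈ Finset.univ,
      Integrable (fun x => fderiv ℝ (G j) x (EuclideanSpace.single j 1)) := fun j _ =>
    (((hGc j).continuous_fderiv one_ne_zero).clm_apply
      continuous_const).integrable_of_hasCompactSupport ((hGs j).fderiv_apply ℝ _)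
  have hdiv : ∀ x ∉ K, ∀ j, fderiv ℝ (G j) x = 0 := fun x hx j =>
    fderiv_eq_zero_of_notMem hK.isClosed (hGK j) hx
  have hsub : ∀ {f g : EuclideanSpace ℝ (Fin 3) → ℝ}, Integrable f → Integrable g →
      Integrable fun x => f x - g x := fun hf hg => hf.sub hg
  have h12 := hsub (h1.const_mul (-σ)) (h2.const_mul (σ - 6 * κ))
  have h13 := hsub h12 (h3.const_mul (2 * σ * lam))
  have h14 := hsub h13 (h4.const_mul (6 * κ))
  have h15 := hsub h14 (h5.const_mul (6 * σ * κ))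
  have h16 := hsub h15 (h6.const_mul (2 * σ))
  rw [setIntegral_eq_integral_of_forall_compl_eq_zero fun x hx => by
      simp [hsupp t ht x hx, hdiv x hx],
    integral_add h16 (integrable_finsetSum _ h7), integral_sub h15 (h6.const_mul _),
    integral_sub h14 (h5.const_mul _), integral_sub h13 (h4.const_mul _),
    integral_sub h12 (h3.const_mul _), integral_sub (h1.const_mul _) (h2.const_mul _),
    integral_finsetSum _ h7, Finset.sum_eq_zero fun j _ =>
      integral_fderiv_eq_zero_of_hasCompactSupport (hGc j) (hGs j) _, add_zero]
  simp only [integral_const_mul]
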